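/- Along every trace of the p-player Hanabi bookkeeping model, the quantity Σ_t is nonincreasing: Σ_{t+1} ≤ Σ_t for every turn t of the trace. -/

import Mathlib

/-- A state of the Hanabi bookkeeping model:
`m` hint tokens, `d` cards left in the deck, `q` remaining turns once the
deck is empty, `f` completed fireworks, `s` score. -/
structure HState where
  m : ℕ
  d : ℕ
  q : ℕ
  f : ℕ
  s : ℕ

/-- The invariants a state must satisfy. -/
def HState.valid (st : HState) : Prop :=
  st.m ≤ 8 ∧ st.f ≤ 5 ∧ 5 * st.f ≤ st.s ∧ st.s ≤ 20 + st.f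

/-- The possible kinds of turns. -/
inductive HAction where
  | hint | discard | playFail | playSucc | playComplete
deriving DecidableEq

/-- Is the action a play (successful or not, possibly firework-completing)? -/
def HAction.isPlay : HAction → Prop
  | .hint => False
  | .discard => False
  | _ => True

instance : DecidablePred HAction.isPlay := by
  intro a; cases a <;> simp [HAction.isPlay] <;> infer_instance

/-- A turn of kind `a` from state `st` to state `st'`. -/
def Step (a : HAction) (st st' : HState) : Prop :=
  st.valid ∧ st'.valid ∧
  -- a turn is allowed only if the score is below 25 and the game is not over
  st.s < 25 ∧ (1 ≤ st.d ∨ 1 ≤ st.q) ∧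
  -- update of the deck size and of the remaining-turns counter
  st'.d = (if 1 ≤ st.d ∧ a ≠ .hint then st.d - 1 else st.d) ∧
  st'.q = (if st.d = 0 then st.q - 1 else st.q) ∧
  -- effect of the individual actions
  (match a with
  | .hint => 1 ≤ st.m ∧ st'.m = st.m - 1 ∧ st'.f = st.f ∧ st'.s = st.s
  | .discard => st.m ≤ 7 ∧ st'.m = st.m + 1 ∧ st'.f = st.f ∧ st'.s = st.s
  | .playFail => st'.m = st.m ∧ st'.f = st.f ∧ st'.s = st.s
  | .playSucc => st'.m = st.m ∧ st'.f = st.f ∧ st'.s = st.s + 1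
  | .playComplete =>
      st.f ≤ 4 ∧ st'.m = min (st.m + 1) 8 ∧ st'.f = st.f + 1 ∧ st'.s = st.s + 1)

/-- Hand size for `p` players. -/
def handSize (p : ℕ) : ℕ := if p ≤ 3 then 5 else 4

/-- Initial deck size for `p` players. -/
def initialDeck (p : ℕ) : ℕ := 50 - p * handSize p

/-- The initial state for `p` players. -/
def initState (p : ℕ) : HState := ⟨8, initialDeck p, p, 0, 0⟩

/-- A trace of length `n` (i.e. with `n` turns) of the `p`-player Hanabi
bookkeeping model: `n + 1` states starting at the initial state, with
consecutive states related by turns. -/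
structure Trace (p n : ℕ) where
  state : Fin (n + 1) → HState
  action : Fin n → HAction
  init : state 0 = initState p
  step : ∀ t : Fin n, Step (action t) (state t.castSucc) (state t.succ)

/-- `c_t`: hint tokens still usable before the deck is empty. -/
def cVal (st : HState) : ℕ := if 1 ≤ st.d then st.m else 0

/-- `u_t`: the undisclosed hints. -/
def uVal (st : HState) : ℕ := if 1 ≤ st.d then st.d - 1 else 0

/-- `Σ_t = t + c_t + d_t + u_t + q_t` along a trace. -/
def sigma {p n : ℕ} (tr : Trace p n) (i : Fin (n + 1)) : ℕ :=
  (i : ℕ) + cVal (tr.state i) + (tr.state i).d + uVal (tr.state i)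
    + (tr.state i).q

/-- Along every trace of the `p`-player Hanabi bookkeeping model, the quantity
`Σ_t` is nonincreasing. -/
theorem hanabi_sigma_nonincreasing (p : ℕ) (hp₂ : 2 ≤ p) (hp₅ : p ≤ 5)
    (n : ℕ) (tr : Trace p n) (t : Fin n) :
    sigma tr t.succ ≤ sigma tr t.castSucc := by
  obtain ⟨-, -, -, hlive, hd, hq, ha⟩ := tr.step t
  simp only [sigma, cVal, uVal, Fin.val_succ, Fin.val_castSucc]
  cases h : tr.action t <;> simp only [h] at hd ha <;> grind
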